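/- arXiv:1001.2193 — 2 statements merged into one kernel-verified Lean document; each statement's English description precedes it below -/
import Mathlib

section
/- Let Γ be a primitive G-set of the form Γ = span((i,0,0),(i_y,j,0),(i_z,0,k)), with y-valley (i_y,0) and z-valley (i_z,0), where i = i(Γ), j = j(Γ), k = k(Γ). Then the triangle of transformations Θ(Γ) = { TUR^m(TUL^n(Γ)) : m,n ∈ ℕ, m+n ≤ min{j,k} } consists of exactly binomial(min{j,k}+2, 2) distinct G-sets. -/
open scoped BigOperators Classical

namespace GH

/-- Exponent vectors of monomials `x^m y^n z^p`. -/
abbrev N3 : Type := ℕ × ℕ × ℕ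

/-- The lattice `ℤ³`. -/
abbrev Z3 : Type := ℤ × ℤ × ℤ

/-- Inclusion `ℕ³ → ℤ³`. -/
def toZ (v : N3) : Z3 := ((v.1 : ℤ), (v.2.1 : ℤ), (v.2.2 : ℤ))

/-- The weight map `wt(m,n,p) = m + a·n + (r−a)·p (mod r)` on `ℤ³`. -/
def wtZ (r a : ℕ) (v : Z3) : ZMod r :=
  (v.1 : ZMod r) + (a : ZMod r) * (v.2.1 : ZMod r) + ((r - a : ℕ) : ZMod r) * (v.2.2 : ZMod r)

/-- The weight map on `ℕ³`. -/
def wtN (r a : ℕ) (v : N3) : ZMod r := wtZ r a (toZ v)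

/-- A `G`-set: contains the origin, closed under taking summands, and the weight map
restricted to it is a bijection onto `ℤ/rℤ`. -/
structure IsGSet (r a : ℕ) (Γ : Set N3) : Prop where
  zero_mem : (0, 0, 0) ∈ Γ
  dclosed : ∀ u v : N3, u + v ∈ Γ → u ∈ Γ ∧ v ∈ Γ
  bij : Set.BijOn (wtN r a) Γ Set.univ

/-- `wt_Γ(v)`: the (unique, for a `G`-set) element of `Γ` of the same weight as `v`. -/
noncomputable def wtG (r a : ℕ) (Γ : Set N3) (v : N3) : N3 :=
  if h : ∃ w, w ∈ Γ ∧ wtN r a w = wtN r a v then h.choose else (0, 0, 0)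

/-- `(m,n)` is a y-valley of `Γ`. -/
def IsYValley (Γ : Set N3) (m n : ℕ) : Prop :=
  (m, n, 0) ∈ Γ ∧ (m + 1, n, 0) ∈ Γ ∧ (m, n + 1, 0) ∈ Γ ∧ (m + 1, n + 1, 0) ∉ Γ

/-- `(m,n)` is a z-valley of `Γ`. -/
def IsZValley (Γ : Set N3) (m n : ℕ) : Prop :=
  (m, 0, n) ∈ Γ ∧ (m + 1, 0, n) ∈ Γ ∧ (m, 0, n + 1) ∈ Γ ∧ (m + 1, 0, n + 1) ∉ Γ

/-- A primitive `G`-set: it has a y-valley `(i_y, 0)` and a z-valley `(i_z, 0)`. -/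
def IsPrimG (Γ : Set N3) : Prop := (∃ p : ℕ, IsYValley Γ p 0) ∧ (∃ p : ℕ, IsZValley Γ p 0)

/-- `s_Γ(v) = v − wt_Γ(v) ∈ ℤ³`. -/
noncomputable def sG (r a : ℕ) (Γ : Set N3) (v : N3) : Z3 := toZ v - toZ (wtG r a Γ v)

/-- The submonoid `S(Γ)` of `ℤ³` generated by all `s_Γ(v)`. -/
noncomputable def SMon (r a : ℕ) (Γ : Set N3) : AddSubmonoid Z3 :=
  AddSubmonoid.closure (Set.range (sG r a Γ))

/-- The lattice `M = { u ∈ ℤ³ : wt(u) = 0 }` of `G`-invariant monomials. -/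
def latM (r a : ℕ) : Set Z3 := { u | wtZ r a u = 0 }

/-- The standard pairing of `ℝ³` with `ℤ³`. -/
def dotR (α : ℝ × ℝ × ℝ) (u : Z3) : ℝ :=
  α.1 * (u.1 : ℝ) + α.2.1 * (u.2.1 : ℝ) + α.2.2 * (u.2.2 : ℝ)

/-- The cone `σ(Γ) = { α ∈ ℝ³ : ⟨α, s_Γ(v)⟩ ≥ 0 for all v ∈ ℕ³ }`. -/
noncomputable def sigmaCone (r a : ℕ) (Γ : Set N3) : Set (ℝ × ℝ × ℝ) :=
  { α | ∀ v : N3, 0 ≤ dotR α (sG r a Γ v) }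

/-- `span(u₁,…,u_t)`: all `v ∈ ℕ³` dominated componentwise by some `u_s`. -/
def spanSet (s : Set N3) : Set N3 := { v | ∃ u ∈ s, v ≤ u }

/-- `i(Γ)`: the largest `m` with `(m,0,0) ∈ Γ`. -/
noncomputable def iOf (Γ : Set N3) : ℕ := sSup { m : ℕ | (m, 0, 0) ∈ Γ }

/-- `j(Γ)`: the largest `n` with `(0,n,0) ∈ Γ`. -/
noncomputable def jOf (Γ : Set N3) : ℕ := sSup { n : ℕ | (0, n, 0) ∈ Γ }

/-- `k(Γ)`: the largest `p` with `(0,0,p) ∈ Γ`. -/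
noncomputable def kOf (Γ : Set N3) : ℕ := sSup { p : ℕ | (0, 0, p) ∈ Γ }

/-- `c(w) = max { c : w − c·v ∈ ℕ³ }` (componentwise). -/
noncomputable def cmax (v w : N3) : ℕ := sSup { c : ℕ | c • v ≤ w }

/-- The `G`-igsaw transformation of `Γ` in the direction of `u`:
`T_u(Γ) = { w + c(w)·(u − v) : w ∈ Γ }` where `v = wt_Γ(u)`. -/
noncomputable def jig (r a : ℕ) (Γ : Set N3) (u : N3) : Set N3 :=
  { w' | ∃ w ∈ Γ,
      toZ w' = toZ w + (cmax (wtG r a Γ u) w) • (toZ u - toZ (wtG r a Γ u)) }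

/-- The upper transformation `TU(Γ)`. -/
noncomputable def TU (r a : ℕ) (Γ : Set N3) : Set N3 := jig r a Γ (iOf Γ + 1, 0, 0)

/-- The right transformation `TR(Γ)`. -/
noncomputable def TR (r a : ℕ) (Γ : Set N3) : Set N3 := jig r a Γ (0, jOf Γ + 1, 0)

/-- The left transformation `TL(Γ)`. -/
noncomputable def TL (r a : ℕ) (Γ : Set N3) : Set N3 := jig r a Γ (0, 0, kOf Γ + 1)

/-- The y-valley of `Γ` (chosen by choice; unique for a `G`-set having one). -/
noncomputable def yValley (Γ : Set N3) : ℕ × ℕ :=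
  if h : ∃ p : ℕ × ℕ, IsYValley Γ p.1 p.2 then h.choose else (0, 0)

/-- The z-valley of `Γ` (chosen by choice; unique for a `G`-set having one). -/
noncomputable def zValley (Γ : Set N3) : ℕ × ℕ :=
  if h : ∃ p : ℕ × ℕ, IsZValley Γ p.1 p.2 then h.choose else (0, 0)

/-- The upper right transformation `TUR(Γ)`, in the direction `(i_y+1, j_y+1, 0)`. -/
noncomputable def TUR (r a : ℕ) (Γ : Set N3) : Set N3 :=
  jig r a Γ ((yValley Γ).1 + 1, (yValley Γ).2 + 1, 0)

/-- The upper left transformation `TUL(Γ)`, in the direction `(i_z+1, 0, k_z+1)`. -/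
noncomputable def TUL (r a : ℕ) (Γ : Set N3) : Set N3 :=
  jig r a Γ ((zValley Γ).1 + 1, 0, (zValley Γ).2 + 1)

/-- The bound `min{j, k, j − j_y, k − k_z}` for the triangle of transformations. -/
noncomputable def minBound (Γ : Set N3) : ℕ :=
  min (min (jOf Γ) (kOf Γ)) (min (jOf Γ - (yValley Γ).2) (kOf Γ - (zValley Γ).2))

/-- The triangle of transformations `Θ(Γ)`. -/
noncomputable def Theta (r a : ℕ) (Γ : Set N3) : Set (Set N3) :=
  { Γ' | ∃ p q : ℕ, p + q ≤ minBound Γ ∧ Γ' = (TUR r a)^[p] ((TUL r a)^[q] Γ) }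

/-- The recursion step producing `Γ_{n+1}` from `Γ_n`. -/
noncomputable def nextGamma (r a : ℕ) (Γ : Set N3) : Set N3 :=
  if jOf Γ < kOf Γ then TU r a ((TUR r a)^[jOf Γ] Γ)
  else TU r a ((TUL r a)^[kOf Γ] Γ)

/-- The sequence of primitive `G`-sets; `GammaSeq r a b (n-1)` is `Γ_n`,
starting from `Γ₁ = span((1,0,0),(0,b−1,0),(0,0,r−b−1))`. -/
noncomputable def GammaSeq (r a b : ℕ) : ℕ → Set N3
  | 0 => spanSet {(1, 0, 0), (0, b - 1, 0), (0, 0, r - b - 1)}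
  | n + 1 => nextGamma r a (GammaSeq r a b n)


lemma wtN_mk {r a : ℕ} (h : a ≤ r) (x y z : ℕ) :
    wtN r a (x, y, z) = (x : ZMod r) + a * y - a * z := by
  simp [wtN, wtZ, toZ, Nat.cast_sub h]
  ring

lemma wtG_eq {r a : ℕ} {Γ : Set N3} (hinj : Set.InjOn (wtN r a) Γ) {u v : N3} (hv : v ∈ Γ)
    (huv : wtN r a v = wtN r a u) : wtG r a Γ u = v := by
  have h : ∃ w, w ∈ Γ ∧ wtN r a w = wtN r a u := ⟨v, hv, huv⟩
  rw [wtG, dif_pos h]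
  exact hinj h.choose_spec.1 hv (h.choose_spec.2.trans huv.symm)

lemma toZ_injective : Function.Injective toZ := by
  rintro ⟨x, y, z⟩ ⟨x', y', z'⟩ h
  simpa [toZ] using h

lemma wtZ_add (r a : ℕ) (u v : Z3) : wtZ r a (u + v) = wtZ r a u + wtZ r a v := by
  simp [wtZ]
  ring

lemma wtZ_sub (r a : ℕ) (u v : Z3) : wtZ r a (u - v) = wtZ r a u - wtZ r a v := by
  simp [wtZ]
  ring

lemma wtZ_nsmul (r a n : ℕ) (u : Z3) : wtZ r a (n • u) = n * wtZ r a u := by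
  simp [wtZ]
  ring

/-- A jigsaw transformation preserves injectivity of the weight map. -/
lemma injOn_jig {r a : ℕ} {Γ : Set N3} (hinj : Set.InjOn (wtN r a) Γ) {u : N3}
    (hu : wtN r a (wtG r a Γ u) = wtN r a u) : Set.InjOn (wtN r a) (jig r a Γ u) := by
  have key : ∀ w' w : N3,
      toZ w' = toZ w + (cmax (wtG r a Γ u) w) • (toZ u - toZ (wtG r a Γ u)) →
      wtN r a w' = wtN r a w := by
    intro w' w h
    simp only [wtN] at hu
    rw [wtN, h, wtZ_add, wtZ_nsmul, wtZ_sub, hu, sub_self, mul_zero, add_zero, wtN]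
  rintro w₁' ⟨w₁, h₁, e₁⟩ w₂' ⟨w₂, h₂, e₂⟩ h
  rw [key _ _ e₁, key _ _ e₂] at h
  obtain rfl := hinj h₁ h₂ h
  exact toZ_injective (e₁.trans e₂.symm)

lemma cmax_z {c : ℕ} (hc : 0 < c) (w : N3) : cmax (0, 0, c) w = w.2.2 / c := by
  obtain ⟨x, y, z⟩ := w
  have : {n : ℕ | n • ((0, 0, c) : N3) ≤ (x, y, z)} = Set.Iic (z / c) := by
    ext n
    simp [Prod.le_def, Nat.le_div_iff_mul_le hc]
  rw [cmax, this, csSup_Iic]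

lemma cmax_y {c : ℕ} (hc : 0 < c) (w : N3) : cmax (0, c, 0) w = w.2.1 / c := by
  obtain ⟨x, y, z⟩ := w
  have : {n : ℕ | n • ((0, c, 0) : N3) ≤ (x, y, z)} = Set.Iic (y / c) := by
    ext n
    simp [Prod.le_def, Nat.le_div_iff_mul_le hc]
  rw [cmax, this, csSup_Iic]

lemma yValley_eq {Γ : Set N3} {m n : ℕ} (h : IsYValley Γ m n)
    (hu : ∀ m' n', IsYValley Γ m' n' → m' = m ∧ n' = n) : yValley Γ = (m, n) := by
  have h' : ∃ p : ℕ × ℕ, IsYValley Γ p.1 p.2 := ⟨(m, n), h⟩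
  rw [yValley, dif_pos h']
  exact Prod.ext_iff.2 (hu _ _ h'.choose_spec)

lemma zValley_eq {Γ : Set N3} {m n : ℕ} (h : IsZValley Γ m n)
    (hu : ∀ m' n', IsZValley Γ m' n' → m' = m ∧ n' = n) : zValley Γ = (m, n) := by
  have h' : ∃ p : ℕ × ℕ, IsZValley Γ p.1 p.2 := ⟨(m, n), h⟩
  rw [zValley, dif_pos h']
  exact Prod.ext_iff.2 (hu _ _ h'.choose_spec)

/-- The member of the triangle obtained by `p` upper right and `q` upper left transformations. -/
def triangleSet (i iy iz j k p q : ℕ) : Set N3 :=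
  {w | (w.2.2 = 0 ∧ (w.1 ≤ i ∧ w.2.1 ≤ p ∨ w.1 ≤ iy ∧ w.2.1 ≤ j - q)) ∨
    (w.2.1 = 0 ∧ (w.1 ≤ i ∧ w.2.2 ≤ q ∨ w.1 ≤ iz ∧ w.2.2 ≤ k - p))}

lemma mem_triangleSet {i iy iz j k p q x y z : ℕ} :
    (x, y, z) ∈ triangleSet i iy iz j k p q ↔
      (z = 0 ∧ (x ≤ i ∧ y ≤ p ∨ x ≤ iy ∧ y ≤ j - q)) ∨
        (y = 0 ∧ (x ≤ i ∧ z ≤ q ∨ x ≤ iz ∧ z ≤ k - p)) :=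
  Iff.rfl

lemma yValley_triangleSet {i iy iz j k p q : ℕ} (hy : iy < i) (hz : iz < i) (hpq : p + q < min j k) :
    yValley (triangleSet i iy iz j k p q) = (iy, p) := by
  apply yValley_eq
  · simp only [IsYValley, mem_triangleSet]
    grind
  · intro m n
    simp only [IsYValley, mem_triangleSet]
    grind

lemma zValley_triangleSet {i iy iz j k p q : ℕ} (hy : iy < i) (hz : iz < i) (hpq : p + q < min j k) :
    zValley (triangleSet i iy iz j k p q) = (iz, q) := by
  apply zValley_eq
  · simp only [IsZValley, mem_triangleSet]
    grind
  · intro m n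
    simp only [IsZValley, mem_triangleSet]
    grind

lemma TUR_triangleSet {r a i iy iz j k p q : ℕ} (har : a ≤ r) (hi : i = iy + iz + 1)
    (hy : ((iy + 1 : ℕ) : ZMod r) + a * (k + 1 : ℕ) = 0)
    (hinj : Set.InjOn (wtN r a) (triangleSet i iy iz j k p q)) (hpq : p + q < min j k) :
    TUR r a (triangleSet i iy iz j k p q) = triangleSet i iy iz j k (p + 1) q ∧
      Set.InjOn (wtN r a) (triangleSet i iy iz j k (p + 1) q) := by
  have hv : ((0, 0, k - p) : N3) ∈ triangleSet i iy iz j k p q := by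
    simp [mem_triangleSet]
  have hw : wtN r a (0, 0, k - p) = wtN r a (iy + 1, p + 1, 0) := by
    rw [wtN_mk har, wtN_mk har, Nat.cast_sub (by omega)]
    push_cast at hy ⊢
    linear_combination -hy
  have hg := wtG_eq hinj hv hw
  have hT : TUR r a (triangleSet i iy iz j k p q) = triangleSet i iy iz j k (p + 1) q := by
    rw [TUR, yValley_triangleSet (by omega) (by omega) hpq]
    ext ⟨x, y, z⟩
    simp only [jig, hg, Set.mem_ofPred_eq, cmax_z (show 0 < k - p by omega)]
    constructor
    · rintro ⟨⟨x', y', z'⟩, hm, he⟩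
      rw [mem_triangleSet] at hm ⊢
      rcases Nat.lt_or_ge z' (k - p) with h | h
      · simp [Nat.div_eq_of_lt h, toZ] at he
        omega
      · obtain rfl : z' = k - p := by omega
        simp [Nat.div_self (show 0 < k - p by omega), toZ] at he
        omega
    · intro hm
      rw [mem_triangleSet] at hm
      by_cases h : y = p + 1 ∧ iy < x
      · refine ⟨(x - (iy + 1), 0, k - p), mem_triangleSet.2 (by omega), ?_⟩
        simp [Nat.div_self (show 0 < k - p by omega), toZ]
        omega
      · refine ⟨(x, y, z), mem_triangleSet.2 (by omega), ?_⟩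
        simp [Nat.div_eq_of_lt (show z < k - p by omega)]
  refine ⟨hT, ?_⟩
  rw [← hT, TUR, yValley_triangleSet (by omega) (by omega) hpq]
  exact injOn_jig hinj (by rw [hg, hw])

lemma TUL_triangleSet {r a i iy iz j k p q : ℕ} (har : a ≤ r) (hi : i = iy + iz + 1)
    (hz : ((iz + 1 : ℕ) : ZMod r) - a * (j + 1 : ℕ) = 0)
    (hinj : Set.InjOn (wtN r a) (triangleSet i iy iz j k p q)) (hpq : p + q < min j k) :
    TUL r a (triangleSet i iy iz j k p q) = triangleSet i iy iz j k p (q + 1) ∧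
      Set.InjOn (wtN r a) (triangleSet i iy iz j k p (q + 1)) := by
  have hv : ((0, j - q, 0) : N3) ∈ triangleSet i iy iz j k p q := by
    simp [mem_triangleSet]
  have hw : wtN r a (0, j - q, 0) = wtN r a (iz + 1, 0, q + 1) := by
    rw [wtN_mk har, wtN_mk har, Nat.cast_sub (by omega)]
    push_cast at hz ⊢
    linear_combination -hz
  have hg := wtG_eq hinj hv hw
  have hT : TUL r a (triangleSet i iy iz j k p q) = triangleSet i iy iz j k p (q + 1) := by
    rw [TUL, zValley_triangleSet (by omega) (by omega) hpq]
    ext ⟨x, y, z⟩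
    simp only [jig, hg, Set.mem_ofPred_eq, cmax_y (show 0 < j - q by omega)]
    constructor
    · rintro ⟨⟨x', y', z'⟩, hm, he⟩
      rw [mem_triangleSet] at hm ⊢
      rcases Nat.lt_or_ge y' (j - q) with h | h
      · simp [Nat.div_eq_of_lt h, toZ] at he
        omega
      · obtain rfl : y' = j - q := by omega
        simp [Nat.div_self (show 0 < j - q by omega), toZ] at he
        omega
    · intro hm
      rw [mem_triangleSet] at hm
      by_cases h : z = q + 1 ∧ iz < x
      · refine ⟨(x - (iz + 1), j - q, 0), mem_triangleSet.2 (by omega), ?_⟩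
        simp [Nat.div_self (show 0 < j - q by omega), toZ]
        omega
      · refine ⟨(x, y, z), mem_triangleSet.2 (by omega), ?_⟩
        simp [Nat.div_eq_of_lt (show y < j - q by omega)]
  refine ⟨hT, ?_⟩
  rw [← hT, TUL, zValley_triangleSet (by omega) (by omega) hpq]
  exact injOn_jig hinj (by rw [hg, hw])

lemma iterate_triangleSet {r a i iy iz j k : ℕ} (har : a ≤ r) (hi : i = iy + iz + 1)
    (hy : ((iy + 1 : ℕ) : ZMod r) + a * (k + 1 : ℕ) = 0)
    (hz : ((iz + 1 : ℕ) : ZMod r) - a * (j + 1 : ℕ) = 0)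
    (hinj : Set.InjOn (wtN r a) (triangleSet i iy iz j k 0 0)) {p q : ℕ}
    (hpq : p + q ≤ min j k) :
    (TUR r a)^[p] ((TUL r a)^[q] (triangleSet i iy iz j k 0 0)) =
        triangleSet i iy iz j k p q ∧
      Set.InjOn (wtN r a) (triangleSet i iy iz j k p q) := by
  induction p with
  | zero =>
    induction q with
    | zero => exact ⟨rfl, hinj⟩
    | succ q ih =>
      obtain ⟨h₁, h₂⟩ := ih (by omega)
      rw [Function.iterate_zero, id] at h₁ ⊢
      rw [Function.iterate_succ_apply', h₁]
      exact TUL_triangleSet har hi hz h₂ (by omega)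
  | succ p ih =>
    obtain ⟨h₁, h₂⟩ := ih (by omega)
    rw [Function.iterate_succ_apply', h₁]
    exact TUR_triangleSet har hi hy h₂ (by omega)

lemma triangleSet_inj {i iy iz j k p q p' q' : ℕ} (hy : iy < i) (hz : iz < i)
    (h : triangleSet i iy iz j k p q = triangleSet i iy iz j k p' q') : p = p' ∧ q = q' := by
  have h₁ := Set.ext_iff.1 h (i, p, 0)
  have h₂ := Set.ext_iff.1 h (i, p', 0)
  have h₃ := Set.ext_iff.1 h (i, 0, q)
  have h₄ := Set.ext_iff.1 h (i, 0, q')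
  simp only [mem_triangleSet] at h₁ h₂ h₃ h₄
  grind

lemma ncard_triangle (i iy iz j k N : ℕ) (hy : iy < i) (hz : iz < i) :
    {Γ' : Set N3 | ∃ p q : ℕ, p + q ≤ N ∧ Γ' = triangleSet i iy iz j k p q}.ncard =
      (N + 2).choose 2 := by
  have hS : {Γ' : Set N3 | ∃ p q : ℕ, p + q ≤ N ∧ Γ' = triangleSet i iy iz j k p q} =
      (fun t : (_ : ℕ) × (ℕ × ℕ) => triangleSet i iy iz j k t.2.1 t.2.2) ''
        ((Finset.range (N + 1)).sigma fun n => Finset.HasAntidiagonal.antidiagonal n) := by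
    ext Γ'
    simp only [Set.mem_ofPred_eq, Set.mem_image, Finset.mem_coe, Finset.mem_sigma,
      Finset.mem_range, Finset.HasAntidiagonal.mem_antidiagonal]
    constructor
    · rintro ⟨p, q, h, rfl⟩
      exact ⟨⟨p + q, p, q⟩, ⟨Nat.lt_succ_of_le h, rfl⟩, rfl⟩
    · rintro ⟨⟨n, p, q⟩, ⟨h, h'⟩, rfl⟩
      dsimp only at h h'
      exact ⟨p, q, by omega, rfl⟩
  rw [hS, Set.InjOn.ncard_image, Set.ncard_coe_finset, Finset.card_sigma]
  · simp only [Finset.Nat.card_antidiagonal]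
    clear hS
    induction N with
    | zero => rfl
    | succ N ih =>
      rw [Finset.sum_range_succ, ih, Nat.choose_succ_succ' (N + 2) 1, Nat.choose_one_right,
        one_add_one_eq_two]
      omega
  · rintro ⟨n, p, q⟩ h ⟨n', p', q'⟩ h' e
    simp only [Finset.mem_coe, Finset.mem_sigma, Finset.HasAntidiagonal.mem_antidiagonal] at h h'
    obtain ⟨rfl, rfl⟩ := triangleSet_inj hy hz e
    obtain rfl : n = n' := h.2.symm.trans h'.2
    rfl

lemma spanSet_eq_triangleSet (i iy iz j k : ℕ) :
    spanSet {(i, 0, 0), (iy, j, 0), (iz, 0, k)} = triangleSet i iy iz j k 0 0 := by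
  ext ⟨x, y, z⟩
  simp [spanSet, mem_triangleSet, Prod.le_def]
  omega

/-- The weight relation given by the y-valley. -/
lemma yValley_weight {r a i iy iz j k : ℕ} (har : a ≤ r) (hy : iy < i) (hj : 0 < j)
    (hsurj : Set.SurjOn (wtN r a) (triangleSet i iy iz j k 0 0) Set.univ)
    (hinj : Set.InjOn (wtN r a) (triangleSet i iy iz j k 0 0)) :
    ((iy + 1 : ℕ) : ZMod r) + a * (k + 1 : ℕ) = 0 := by
  have inj : ∀ {x y z x' y' z' : ℕ}, (x, y, z) ∈ triangleSet i iy iz j k 0 0 →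
      (x', y', z') ∈ triangleSet i iy iz j k 0 0 →
      (x : ZMod r) + a * y - a * z = x' + a * y' - a * z' → x = x' ∧ y = y' ∧ z = z' := by
    intro x y z x' y' z' h h' e
    simpa using hinj h h' (by rw [wtN_mk har, wtN_mk har, e])
  obtain ⟨⟨m, n, p⟩, hm, e⟩ := hsurj (Set.mem_univ (wtN r a (iy + 1, 1, 0)))
  rw [wtN_mk har, wtN_mk har] at e
  have hn : n = 0 := by
    by_contra hn
    obtain ⟨n, rfl⟩ := Nat.exists_eq_succ_of_ne_zero hn
    have := inj (x := m) (y := n) (z := p) (x' := iy + 1) (y' := 0) (z' := 0)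
      (by rw [mem_triangleSet] at hm ⊢; omega) (by rw [mem_triangleSet]; omega)
      (by push_cast at e ⊢; linear_combination e)
    rw [mem_triangleSet] at hm
    omega
  subst hn
  have hm0 : m = 0 := by
    by_contra hm0
    rcases le_or_gt m (iy + 1) with h | h
    · have := inj (x := 0) (y := 0) (z := p) (x' := iy + 1 - m) (y' := 1) (z' := 0)
        (by rw [mem_triangleSet] at hm ⊢; omega) (by rw [mem_triangleSet]; omega)
        (by rw [Nat.cast_sub h]; push_cast at e ⊢; linear_combination e)
      omega
    · have := inj (x := m - (iy + 1)) (y := 0) (z := p) (x' := 0) (y' := 1) (z' := 0)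
        (by rw [mem_triangleSet] at hm ⊢; omega) (by rw [mem_triangleSet]; omega)
        (by rw [Nat.cast_sub h.le]; push_cast at e ⊢; linear_combination e)
      omega
  subst hm0
  have hp : p = k := by
    by_contra hp
    have := inj (x := 0) (y := 0) (z := p + 1) (x' := iy + 1) (y' := 0) (z' := 0)
      (by rw [mem_triangleSet] at hm ⊢; omega) (by rw [mem_triangleSet]; omega)
      (by push_cast at e ⊢; linear_combination e)
    omega
  subst hp
  push_cast at e ⊢
  linear_combination -e

/-- The weight relation given by the z-valley. -/
lemma zValley_weight {r a i iy iz j k : ℕ} (har : a ≤ r) (hz : iz < i) (hk : 0 < k)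
    (hsurj : Set.SurjOn (wtN r a) (triangleSet i iy iz j k 0 0) Set.univ)
    (hinj : Set.InjOn (wtN r a) (triangleSet i iy iz j k 0 0)) :
    ((iz + 1 : ℕ) : ZMod r) - a * (j + 1 : ℕ) = 0 := by
  have inj : ∀ {x y z x' y' z' : ℕ}, (x, y, z) ∈ triangleSet i iy iz j k 0 0 →
      (x', y', z') ∈ triangleSet i iy iz j k 0 0 →
      (x : ZMod r) + a * y - a * z = x' + a * y' - a * z' → x = x' ∧ y = y' ∧ z = z' := by
    intro x y z x' y' z' h h' e
    simpa using hinj h h' (by rw [wtN_mk har, wtN_mk har, e])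
  obtain ⟨⟨m, n, p⟩, hm, e⟩ := hsurj (Set.mem_univ (wtN r a (iz + 1, 0, 1)))
  rw [wtN_mk har, wtN_mk har] at e
  have hp : p = 0 := by
    by_contra hp
    obtain ⟨p, rfl⟩ := Nat.exists_eq_succ_of_ne_zero hp
    have := inj (x := m) (y := n) (z := p) (x' := iz + 1) (y' := 0) (z' := 0)
      (by rw [mem_triangleSet] at hm ⊢; omega) (by rw [mem_triangleSet]; omega)
      (by push_cast at e ⊢; linear_combination e)
    rw [mem_triangleSet] at hm
    omega
  subst hp
  have hm0 : m = 0 := by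
    by_contra hm0
    rcases le_or_gt m (iz + 1) with h | h
    · have := inj (x := 0) (y := n) (z := 0) (x' := iz + 1 - m) (y' := 0) (z' := 1)
        (by rw [mem_triangleSet] at hm ⊢; omega) (by rw [mem_triangleSet]; omega)
        (by rw [Nat.cast_sub h]; push_cast at e ⊢; linear_combination e)
      omega
    · have := inj (x := m - (iz + 1)) (y := n) (z := 0) (x' := 0) (y' := 0) (z' := 1)
        (by rw [mem_triangleSet] at hm ⊢; omega) (by rw [mem_triangleSet]; omega)
        (by rw [Nat.cast_sub h.le]; push_cast at e ⊢; linear_combination e)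
      omega
  subst hm0
  have hn : n = j := by
    by_contra hn
    have := inj (x := 0) (y := n + 1) (z := 0) (x' := iz + 1) (y' := 0) (z' := 0)
      (by rw [mem_triangleSet] at hm ⊢; omega) (by rw [mem_triangleSet]; omega)
      (by push_cast at e ⊢; linear_combination e)
    omega
  subst hn
  push_cast at e ⊢
  linear_combination -e

lemma length_eq_add {r a i iy iz j k : ℕ} (har : a ≤ r) (hy : iy < i) (hz : iz < i)
    (hj : 0 < j) (hk : 0 < k)
    (hsurj : Set.SurjOn (wtN r a) (triangleSet i iy iz j k 0 0) Set.univ)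
    (hinj : Set.InjOn (wtN r a) (triangleSet i iy iz j k 0 0)) : i = iy + iz + 1 := by
  have ey := yValley_weight har hy hj hsurj hinj
  have ez := zValley_weight har hz hk hsurj hinj
  have inj : ∀ {x y z x' y' z' : ℕ}, (x, y, z) ∈ triangleSet i iy iz j k 0 0 →
      (x', y', z') ∈ triangleSet i iy iz j k 0 0 →
      (x : ZMod r) + a * y - a * z = x' + a * y' - a * z' → x = x' ∧ y = y' ∧ z = z' := by
    intro x y z x' y' z' h h' e
    simpa using hinj h h' (by rw [wtN_mk har, wtN_mk har, e])
  push_cast at ey ez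
  apply le_antisymm
  · by_contra! h
    rcases le_total k j with hkj | hkj
    · have := inj (x := iy + iz + 2) (y := 0) (z := 0) (x' := 0) (y' := j - k) (z' := 0)
        (by rw [mem_triangleSet]; omega) (by rw [mem_triangleSet]; omega)
        (by rw [Nat.cast_sub hkj]; push_cast; linear_combination ey + ez)
      omega
    · have := inj (x := iy + iz + 2) (y := 0) (z := 0) (x' := 0) (y' := 0) (z' := k - j)
        (by rw [mem_triangleSet]; omega) (by rw [mem_triangleSet]; omega)
        (by rw [Nat.cast_sub hkj]; push_cast; linear_combination ey + ez)
      omega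
  · by_contra! h
    obtain ⟨⟨m, n, p⟩, hm, e⟩ := hsurj (Set.mem_univ (wtN r a (i + 1, 0, 0)))
    rw [wtN_mk har, wtN_mk har] at e
    push_cast at e
    rw [mem_triangleSet] at hm
    have hm0 : m = 0 := by
      by_contra hm0
      obtain ⟨m, rfl⟩ := Nat.exists_eq_succ_of_ne_zero hm0
      have := inj (x := m) (y := n) (z := p) (x' := i) (y' := 0) (z' := 0)
        (by rw [mem_triangleSet]; omega) (by rw [mem_triangleSet]; omega)
        (by push_cast at e ⊢; linear_combination e)
      omega
    subst hm0
    rcases Nat.eq_zero_or_pos p with rfl | hp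
    · rcases Nat.eq_zero_or_pos n with rfl | hn
      · have := inj (x := i - iz) (y := j) (z := 0) (x' := 0) (y' := 0) (z' := 1)
          (by rw [mem_triangleSet]; omega) (by rw [mem_triangleSet]; omega)
          (by rw [Nat.cast_sub hz.le]; push_cast at e ⊢; linear_combination -e - ez)
        omega
      · have := inj (x := i - iz) (y := j + 1 - n) (z := 0) (x' := 0) (y' := 0) (z' := 0)
          (by rw [mem_triangleSet]; omega) (by rw [mem_triangleSet]; omega)
          (by
            rw [Nat.cast_sub hz.le, Nat.cast_sub (by omega)]
            push_cast at e ⊢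
            linear_combination -e - ez)
        omega
    · obtain rfl : n = 0 := by omega
      have := inj (x := i - iy) (y := 0) (z := k + 1 - p) (x' := 0) (y' := 0) (z' := 0)
        (by rw [mem_triangleSet]; omega) (by rw [mem_triangleSet]; omega)
        (by
          rw [Nat.cast_sub hy.le, Nat.cast_sub (by omega)]
          push_cast at e ⊢
          linear_combination -e - ey)
      omega

/-- The triangle of transformations of a primitive `G`-set consists of exactly
`binom(min(j,k)+2, 2)` distinct `G`-sets. -/
theorem stmt14 (r a : ℕ) (hra : Nat.Coprime r a) (ha2 : 2 ≤ a) (halt : a < r - a) (Γ : Set N3) (hΓ : IsGSet r a Γ)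
    (i iy iz j k : ℕ)
    (hyv : IsYValley Γ iy 0) (hzv : IsZValley Γ iz 0)
    (hyu : ∀ m n : ℕ, IsYValley Γ m n → (m, n) = (iy, 0))
    (hzu : ∀ m n : ℕ, IsZValley Γ m n → (m, n) = (iz, 0))
    (hspan : Γ = spanSet {(i, 0, 0), (iy, j, 0), (iz, 0, k)})
    (hi : (i, 0, 0) ∈ Γ ∧ (i + 1, 0, 0) ∉ Γ)
    (hj : (0, j, 0) ∈ Γ ∧ (0, j + 1, 0) ∉ Γ)
    (hk : (0, 0, k) ∈ Γ ∧ (0, 0, k + 1) ∉ Γ) :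
    {Γ' : Set N3 | ∃ p q : ℕ, p + q ≤ min j k ∧
        Γ' = (TUR r a)^[p] ((TUL r a)^[q] Γ)}.ncard = (min j k + 2).choose 2 := by
  subst hspan
  rw [spanSet_eq_triangleSet] at *
  have har : a ≤ r := by omega
  have hinj := hΓ.bij.injOn
  have hsurj := hΓ.bij.surjOn
  simp only [IsYValley, IsZValley, mem_triangleSet] at hyv hzv
  have hy : iy < i := by omega
  have hz : iz < i := by omega
  have hj0 : 0 < j := by omega
  have hk0 : 0 < k := by omega
  have hiyz := length_eq_add har hy hz hj0 hk0 hsurj hinj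
  have ey := yValley_weight har hy hj0 hsurj hinj
  have ez := zValley_weight har hz hk0 hsurj hinj
  rw [← ncard_triangle i iy iz j k (min j k) hy hz]
  congr 1
  ext Γ'
  refine exists_congr fun p => exists_congr fun q => and_congr_right fun hpq => ?_
  rw [(iterate_triangleSet har hiyz ey ez hinj hpq).1]

end GH
end

section
/- The collection of all G-sets (for the fixed data r, a) is finite, and its cardinality equals (3r + b(r−b) − 1)/2, where b is the unique integer with 1 ≤ b ≤ r−1 and a·b ≡ 1 (mod r). -/
open scoped BigOperators Classical

namespace GH

/-! ### Refinement of two-gap configurations -/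

/-- A two-gap configuration: the multiples `0, b, …, (u + v - 1) b` cut the cycle `ℤ/rℤ` into `v`
arcs of length `α` and `u` arcs of length `β`. -/
@[ext] structure GapData where
  u : ℕ
  v : ℕ
  α : ℕ
  β : ℕ

namespace GapData

/-- `y` is obtained from `x` by a unimodular matrix with nonnegative entries. -/
def Refines (x y : GapData) : Prop :=
  0 < y.α ∧ 0 < y.β ∧ ∃ c d e f : ℕ, c * f = d * e + 1 ∧
    y.u = c * x.u + d * x.v ∧ y.v = e * x.u + f * x.v ∧
    y.α + d * x.β = c * x.α ∧ y.β + e * x.α = f * x.β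

/-- Exchange of the two gap lengths. -/
def swap (x : GapData) : GapData := ⟨x.v, x.u, x.β, x.α⟩

lemma swap_inj {x y : GapData} : x.swap = y.swap ↔ x = y := by
  simp only [swap, GapData.ext_iff]
  tauto

lemma Refines.swap {x y : GapData} (h : Refines x y) : Refines x.swap y.swap := by
  obtain ⟨h1, h2, c, d, e, f, h3, h4, h5, h6, h7⟩ := h
  exact ⟨h2, h1, f, e, d, c, by linarith, by simp only [GapData.swap]; linarith,
    by simp only [GapData.swap]; linarith, h7, h6⟩

lemma refines_swap {x y : GapData} : Refines x.swap y.swap ↔ Refines x y :=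
  ⟨fun h => h.swap, fun h => h.swap⟩

lemma Refines.refl {x : GapData} (hα : 0 < x.α) (hβ : 0 < x.β) : Refines x x :=
  ⟨hα, hβ, 1, 0, 0, 1, by simp, by simp, by simp, by simp, by simp⟩

lemma Refines.le {x y : GapData} (h : Refines x y) : x.u + x.v ≤ y.u + y.v := by
  obtain ⟨-, -, c, d, e, f, h3, h4, h5, -⟩ := h
  have hc : 1 ≤ c := by
    rcases Nat.eq_zero_or_pos c with rfl | h
    · simp at h3
    · exact h
  have hf : 1 ≤ f := by
    rcases Nat.eq_zero_or_pos f with rfl | h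
    · simp at h3
    · exact h
  rw [h4, h5]
  nlinarith [Nat.mul_le_mul_right x.u hc, Nat.mul_le_mul_right x.v hf,
    Nat.zero_le (d * x.v), Nat.zero_le (e * x.u)]

lemma refines_iff_of_eq_one {x y : GapData} (hα : x.α = 1) (hβ : x.β = 1) :
    Refines x y ↔ y = x := by
  refine ⟨?_, ?_⟩
  · rintro ⟨h1, h2, c, d, e, f, h3, h4, h5, h6, h7⟩
    rw [hα, hβ] at h6 h7
    have hc : d + 1 ≤ c := by omega
    have hf : e + 1 ≤ f := by omega
    have := Nat.mul_le_mul hc hf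
    have hd : d = 0 := by nlinarith
    have he : e = 0 := by nlinarith
    subst hd he
    have : c = 1 ∧ f = 1 := by simpa using h3
    obtain ⟨rfl, rfl⟩ := this
    ext <;> lia
  · rintro rfl
    exact Refines.refl (by omega) (by omega)

lemma refines_iff_of_lt {u v β γ : ℕ} (hβ : 0 < β) (hγ : 0 < γ) (y : GapData) :
    Refines ⟨u, v, β + γ, β⟩ y ↔ y = ⟨u, v, β + γ, β⟩ ∨ Refines ⟨u + v, v, γ, β⟩ y := by
  refine ⟨?_, ?_⟩
  · rintro ⟨h1, h2, c, d, e, f, h3, h4, h5, h6, h7⟩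
    dsimp only at h4 h5 h6 h7
    have hef : e < f := by nlinarith
    rcases lt_or_ge d c with hdc | hdc
    · left
      have := Nat.mul_le_mul (Nat.succ_le_of_lt hdc) (Nat.succ_le_of_lt hef)
      simp only [Nat.succ_eq_add_one] at this
      have hd : d = 0 := by nlinarith
      have he : e = 0 := by nlinarith
      subst hd he
      have : c = 1 ∧ f = 1 := by simpa using h3
      obtain ⟨rfl, rfl⟩ := this
      ext <;> simp <;> omega
    · right
      obtain ⟨d, rfl⟩ := Nat.exists_eq_add_of_le hdc
      obtain ⟨f, rfl⟩ := Nat.exists_eq_add_of_le hef.le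
      exact ⟨h1, h2, c, d, e, f, by linarith, by dsimp only; linarith, by dsimp only; linarith,
        by dsimp only; linarith, by dsimp only; linarith⟩
  · rintro (rfl | ⟨h1, h2, c, d, e, f, h3, h4, h5, h6, h7⟩)
    · exact Refines.refl (by dsimp only; omega) hβ
    · dsimp only at h4 h5 h6 h7
      exact ⟨h1, h2, c, c + d, e, e + f, by linarith, by dsimp only; linarith,
        by dsimp only; linarith, by dsimp only; linarith, by dsimp only; linarith⟩

/-- The refinements of `x` form a finite family, determined by their number of points. -/
lemma exists_finset_refines (n : ℕ) : ∀ x : GapData, x.α + x.β = n → 0 < x.u → 0 < x.v →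
    0 < x.α → 0 < x.β → Nat.Coprime x.α x.β →
    ∃ F : Finset GapData, (∀ y, y ∈ F ↔ Refines x y) ∧
      (∀ y ∈ F, ∀ z ∈ F, y.u + y.v = z.u + z.v → y = z) ∧
      ∑ y ∈ F, min y.α y.β * (min y.α y.β + 1) + 1 = x.α * x.β + x.α + x.β := by
  induction n using Nat.strong_induction_on with
  | _ n ih =>
  -- the case of a longer first gap
  have key : ∀ x : GapData, x.α + x.β = n → 0 < x.u → 0 < x.v →
      0 < x.β → x.β < x.α → Nat.Coprime x.α x.β →
      ∃ F : Finset GapData, (∀ y, y ∈ F ↔ Refines x y) ∧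
        (∀ y ∈ F, ∀ z ∈ F, y.u + y.v = z.u + z.v → y = z) ∧
        ∑ y ∈ F, min y.α y.β * (min y.α y.β + 1) + 1 = x.α * x.β + x.α + x.β := by
    rintro ⟨u, v, α, β⟩ hn hu hv hβ hlt hcop
    dsimp only at *
    obtain ⟨γ, rfl⟩ := Nat.exists_eq_add_of_lt hlt
    obtain ⟨F, hF, hinj, hsum⟩ := ih (γ + 1 + β) (by omega) ⟨u + v, v, γ + 1, β⟩ rfl
      (by dsimp only; omega) hv (by dsimp only; omega) hβ
      (by
        have : Nat.Coprime (β + (γ + 1)) β := by simpa [add_assoc] using hcop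
        simpa using this)
    have hbig : ∀ y ∈ F, u + v < y.u + y.v := fun y hy => by
      have := ((hF y).1 hy).le
      dsimp only at this
      omega
    have hnot : (⟨u, v, β + γ + 1, β⟩ : GapData) ∉ F := fun h => by
      simpa using hbig _ h
    refine ⟨insert ⟨u, v, β + γ + 1, β⟩ F, fun y => ?_, ?_, ?_⟩
    · rw [Finset.mem_insert, hF, add_assoc, refines_iff_of_lt hβ (Nat.succ_pos γ)]
    · intro y hy z hz hyz
      rw [Finset.mem_insert] at hy hz
      rcases hy with rfl | hy <;> rcases hz with rfl | hz
      · rfl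
      · have := hbig _ hz
        dsimp only at hyz
        omega
      · have := hbig _ hy
        dsimp only at hyz
        omega
      · exact hinj y hy z hz hyz
    · rw [Finset.sum_insert hnot]
      dsimp only at hsum ⊢
      rw [min_eq_right (by omega : β ≤ β + γ + 1)]
      linarith
  intro x hn hu hv hα hβ hcop
  rcases lt_trichotomy x.β x.α with hlt | heq | hlt
  · exact key x hn hu hv hβ hlt hcop
  · have h1 : x.α = 1 := by rw [heq] at hcop; simpa using hcop
    have h2 : x.β = 1 := by omega
    refine ⟨{x}, fun y => ?_, ?_, ?_⟩
    · rw [Finset.mem_singleton, refines_iff_of_eq_one h1 h2]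
    · simp
    · simp [h1, h2]
  · obtain ⟨F, hF, hinj, hsum⟩ := key x.swap (by simp only [swap]; omega) hv hu hα hlt hcop.symm
    refine ⟨F.image swap, fun y => ?_, ?_, ?_⟩
    · rw [Finset.mem_image, ← refines_swap, ← hF]
      exact ⟨by rintro ⟨z, hz, rfl⟩; exact hz, fun h => ⟨y.swap, h, rfl⟩⟩
    · simp only [Finset.forall_mem_image, swap_inj]
      intro y hy z hz hyz
      exact hinj y hy z hz (by simp only [swap] at hyz; omega)
    · rw [Finset.sum_image fun y _ z _ h => swap_inj.1 h]
      simp only [swap] at hsum ⊢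
      simp only [min_comm] at hsum ⊢
      linarith

end GapData

/-! ### Tilings of the cycle by nested intervals -/

/-- Pairs `(m, t)` with `m < N` and `-k m ≤ t ≤ j m`. -/
noncomputable def tileIndex (N : ℕ) (j k : ℕ → ℕ) : Finset (Σ _ : ℕ, ℤ) :=
  (Finset.range N).sigma fun m => Finset.Icc (-(k m : ℤ)) (j m)

/-- The intervals `b m + [-k m, j m]`, `m < N`, tile `ℤ/rℤ`. -/
def Tiles (r b N : ℕ) (j k : ℕ → ℕ) : Prop :=
  Set.BijOn (fun p : Σ _ : ℕ, ℤ => (((b : ℤ) * p.1 + p.2 : ℤ) : ZMod r)) (tileIndex N j k) Set.univ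

lemma mem_tileIndex {N : ℕ} {j k : ℕ → ℕ} {p : Σ _ : ℕ, ℤ} :
    p ∈ tileIndex N j k ↔ p.1 < N ∧ -(k p.1 : ℤ) ≤ p.2 ∧ p.2 ≤ j p.1 := by
  simp [tileIndex]

lemma card_tileIndex (N : ℕ) (j k : ℕ → ℕ) :
    (tileIndex N j k).card = ∑ m ∈ Finset.range N, (j m + k m + 1) := by
  rw [tileIndex, Finset.card_sigma]
  refine Finset.sum_congr rfl fun m _ => ?_
  rw [Int.card_Icc]
  omega

lemma Tiles.sum_eq {r b N : ℕ} [NeZero r] {j k : ℕ → ℕ} (h : Tiles r b N j k) :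
    ∑ m ∈ Finset.range N, (j m + k m + 1) = r := by
  rw [← card_tileIndex, ← ZMod.card r, ← Finset.card_univ]
  refine Finset.card_bij (fun p _ => (((b : ℤ) * p.1 + p.2 : ℤ) : ZMod r))
    (fun _ _ => Finset.mem_univ _) (fun p hp q hq => h.injOn hp hq) fun z _ => ?_
  obtain ⟨p, hp, hz⟩ := h.surjOn (Set.mem_univ z)
  exact ⟨p, hp, hz⟩

lemma tiles_of_cover {r b N : ℕ} [NeZero r] {j k : ℕ → ℕ}
    (hsum : ∑ m ∈ Finset.range N, (j m + k m + 1) = r) (hN : 0 < N)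
    (hnext : ∀ m < N, ∃ w < N, (r : ℤ) ∣ b * m + j m + 1 - (b * w - k w)) :
    Tiles r b N j k := by
  have hsurj : ∀ n : ℕ, ∃ p ∈ tileIndex N j k,
      (((b : ℤ) * p.1 + p.2 : ℤ) : ZMod r) = (n : ZMod r) := by
    intro n
    induction n with
    | zero => exact ⟨⟨0, 0⟩, mem_tileIndex.2 ⟨hN, by simp, by simp⟩, by simp⟩
    | succ n ih =>
      obtain ⟨⟨m, t⟩, hp, hn⟩ := ih
      rw [mem_tileIndex] at hp
      obtain ⟨hm, h1, h2⟩ := hp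
      dsimp only at hm h1 h2 hn
      rcases h2.lt_or_eq with h2 | rfl
      · refine ⟨⟨m, t + 1⟩, mem_tileIndex.2 ⟨hm, by dsimp only; omega, by dsimp only; omega⟩, ?_⟩
        push_cast at hn ⊢
        rw [← hn]
        ring
      · obtain ⟨w, hw, hd⟩ := hnext m hm
        refine ⟨⟨w, -(k w)⟩, mem_tileIndex.2 ⟨hw, le_rfl, by dsimp only; omega⟩, ?_⟩
        have := (ZMod.intCast_eq_intCast_iff_dvd_sub _ _ _).2 hd
        push_cast at this hn ⊢
        rw [← hn, ← this]
        ring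
  have hs : Set.SurjOn (fun p : Σ _ : ℕ, ℤ => (((b : ℤ) * p.1 + p.2 : ℤ) : ZMod r))
      (tileIndex N j k) (Finset.univ : Finset (ZMod r)) := by
    intro z _
    obtain ⟨p, hp, h⟩ := hsurj z.val
    exact ⟨p, hp, by simpa using h⟩
  have hi := Finset.injOn_of_surjOn_of_card_le _ (fun _ _ => Finset.mem_coe.2 (Finset.mem_univ _)) hs
    (by rw [card_tileIndex, hsum, Finset.card_univ, ZMod.card])
  exact ⟨fun _ _ => Set.mem_univ _, hi, by simpa using hs⟩

/-- Every residue lies in some interval `b m + [-k m, j m]`. -/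
def Covers (r : ℕ) (b : ℤ) (N : ℕ) (j k : ℕ → ℕ) : Prop :=
  ∀ z : ℤ, ∃ m < N, ∃ t : ℤ, -(k m : ℤ) ≤ t ∧ t ≤ j m ∧ (r : ℤ) ∣ z - (b * m + t)

/-- Distinct intervals `b m + [-k m, j m]` are disjoint modulo `r`. -/
def Separated (r : ℕ) (b : ℤ) (N : ℕ) (j k : ℕ → ℕ) : Prop :=
  ∀ m < N, ∀ w < N, m ≠ w → ∀ x : ℤ, (r : ℤ) ∣ b * w - b * m - x →
    -(k m + j w : ℤ) ≤ x → x ≤ j m + k w → False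

lemma Tiles.covers {r b N : ℕ} {j k : ℕ → ℕ} (h : Tiles r b N j k) : Covers r b N j k := by
  intro z
  obtain ⟨⟨m, t⟩, hp, hz⟩ := h.surjOn (Set.mem_univ (z : ZMod r))
  obtain ⟨hm, h1, h2⟩ := mem_tileIndex.1 (Finset.mem_coe.1 hp)
  exact ⟨m, hm, t, h1, h2, (ZMod.intCast_eq_intCast_iff_dvd_sub _ _ _).1 hz⟩

lemma Tiles.separated {r b N : ℕ} {j k : ℕ → ℕ} (h : Tiles r b N j k) : Separated r b N j k := by
  intro m hm w hw hne x hd h1 h2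
  have hp : (⟨m, max (-(k m : ℤ)) (x - k w)⟩ : Σ _ : ℕ, ℤ) ∈ tileIndex N j k :=
    mem_tileIndex.2 ⟨hm, by dsimp only; omega, by dsimp only; omega⟩
  have hq : (⟨w, max (-(k m : ℤ)) (x - k w) - x⟩ : Σ _ : ℕ, ℤ) ∈ tileIndex N j k :=
    mem_tileIndex.2 ⟨hw, by dsimp only; omega, by dsimp only; omega⟩
  have := h.injOn hp hq ((ZMod.intCast_eq_intCast_iff_dvd_sub _ _ _).2 (by
    dsimp only
    convert hd using 1
    ring))
  exact hne (congrArg Sigma.fst this)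

lemma Covers.reflect {r N : ℕ} {b : ℤ} {j k : ℕ → ℕ} (h : Covers r b N j k) :
    Covers r (-b) N k j := by
  intro z
  obtain ⟨m, hm, t, h1, h2, hd⟩ := h (-z)
  refine ⟨m, hm, -t, by omega, by omega, ?_⟩
  rw [← Int.dvd_neg]
  convert hd using 1
  ring

lemma Separated.reflect {r N : ℕ} {b : ℤ} {j k : ℕ → ℕ} (h : Separated r b N j k) :
    Separated r (-b) N k j := by
  intro m hm w hw hne x hd h1 h2
  refine h m hm w hw hne (-x) ?_ (by omega) (by omega)
  rw [← Int.dvd_neg]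
  convert hd using 1
  ring

/-- If there are at least two intervals, each one has a right neighbour different from it. -/
lemma exists_next {r N : ℕ} {b : ℤ} {j k : ℕ → ℕ} (hc : Covers r b N j k)
    (hs : Separated r b N j k) (hN : 1 < N) {m : ℕ} (hm : m < N) :
    ∃ w < N, w ≠ m ∧ (r : ℤ) ∣ b * w - b * m - (j m + k w + 1) := by
  obtain ⟨w, hw, t, h1, h2, hd⟩ := hc (b * m + j m + 1)
  by_cases hwm : w = m
  · exfalso
    subst hwm
    obtain ⟨m', hm', hne⟩ : ∃ m' < N, w ≠ m' := by
      rcases Nat.eq_zero_or_pos w with rfl | h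
      · exact ⟨1, hN, by omega⟩
      · exact ⟨0, by omega, by omega⟩
    have hD : (0 : ℤ) < j w + 1 - t := by omega
    have hrD : (r : ℤ) ∣ j w + 1 - t := by
      convert hd using 1
      ring
    have e1 := Int.emod_nonneg (j w - (b * m' - b * w)) hD.ne'
    have e2 := Int.emod_lt_of_pos (j w - (b * m' - b * w)) hD
    have e3 := Int.emod_add_mul_ediv (j w - (b * m' - b * w)) (j w + 1 - t)
    set ρ := (j w - (b * m' - b * w)) % (j w + 1 - t)
    set κ := (j w - (b * m' - b * w)) / (j w + 1 - t)
    refine hs w hw m' hm' hne (j w - ρ) ?_ (by omega) (by omega)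
    have : b * m' - b * w - (j w - ρ) = (j w + 1 - t) * (-κ) := by linarith
    rw [this]
    exact hrD.mul_right _
  · refine ⟨w, hw, hwm, ?_⟩
    have hd' : (r : ℤ) ∣ b * w - b * m - (j m + 1 - t) := by
      rw [← Int.dvd_neg]
      convert hd using 1
      ring
    rcases h1.eq_or_lt with rfl | h1
    · convert hd' using 1
      ring
    · exact (hs m hm w hw (Ne.symm hwm) _ hd' (by omega) (by omega)).elim

/-- A tiling by at least two nested intervals has exactly two gap lengths. -/
lemma exists_two_gap {r N : ℕ} {b : ℤ} {j k : ℕ → ℕ} (hc : Covers r b N j k)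
    (hs : Separated r b N j k) (hN : 1 < N)
    (hj : ∀ m n, m ≤ n → n < N → j n ≤ j m) (hk : ∀ m n, m ≤ n → n < N → k n ≤ k m) :
    ∃ u v, 0 < u ∧ 0 < v ∧ N = u + v ∧
      (r : ℤ) ∣ b * u - (j 0 + k u + 1) ∧ (r : ℤ) ∣ b * v + (j v + k 0 + 1) ∧
      (∀ m < v, j m = j 0) ∧ (∀ m, v ≤ m → m < N → j m = j v) ∧
      (∀ m < u, k m = k 0) ∧ (∀ m, u ≤ m → m < N → k m = k u) := by
  obtain ⟨u, huN, hu0, hu⟩ := exists_next hc hs hN (by omega : 0 < N)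
  obtain ⟨v, hvN, hv0, hv⟩ := exists_next hc.reflect hs.reflect hN (by omega : 0 < N)
  have hu : (r : ℤ) ∣ b * u - (j 0 + k u + 1) := by simpa using hu
  have hv : (r : ℤ) ∣ b * v + (j v + k 0 + 1) := by
    rw [← Int.dvd_neg]
    convert hv using 1
    push_cast
    ring
  have hstep : ∀ m < N, (m + u < N ∧ j m = j 0 ∧ k (m + u) = k u) ∨
      (v ≤ m ∧ j m = j v ∧ k (m - v) = k 0) := by
    intro m hm
    obtain ⟨w, hw, hwm, hd⟩ := exists_next hc hs hN hm
    rcases lt_or_gt_of_ne hwm with hlt | hlt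
    · right
      obtain ⟨d, rfl⟩ := Nat.exists_eq_add_of_lt hlt
      have hd' : (r : ℤ) ∣ b * (d + 1 : ℕ) - b * (0 : ℕ) - -(j (w + d + 1) + k w + 1 : ℤ) := by
        rw [← Int.dvd_neg]
        convert hd using 1
        push_cast
        ring
      have a1 := hj (d + 1) (w + d + 1) (by omega) hm
      have a2 := hk 0 w (by omega) hw
      have a3 : j (w + d + 1) = j (d + 1) ∧ k w = k 0 := by
        by_contra hcon
        exact hs 0 (by omega) (d + 1) (by omega) (by omega) _ hd' (by omega) (by omega)
      have a4 : d + 1 = v := by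
        by_contra hcon
        refine hs (d + 1) (by omega) v hvN hcon (j (d + 1) - j v) ?_ (by omega) (by omega)
        convert Int.dvd_sub hv hd' using 1
        rw [a3.1, a3.2]
        push_cast
        ring
      subst a4
      refine ⟨by omega, a3.1, ?_⟩
      rw [show w + d + 1 - (d + 1) = w by omega, a3.2]
    · left
      obtain ⟨d, rfl⟩ := Nat.exists_eq_add_of_lt hlt
      have hd' : (r : ℤ) ∣ b * (d + 1 : ℕ) - b * (0 : ℕ) - (j m + k (m + d + 1) + 1 : ℤ) := by
        convert hd using 1
        push_cast
        ring
      have a1 := hk (d + 1) (m + d + 1) (by omega) hw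
      have a2 := hj 0 m (by omega) hm
      have a3 : j m = j 0 ∧ k (m + d + 1) = k (d + 1) := by
        by_contra hcon
        exact hs 0 (by omega) (d + 1) (by omega) (by omega) _ hd' (by omega) (by omega)
      have a4 : d + 1 = u := by
        by_contra hcon
        refine hs (d + 1) (by omega) u huN hcon (k u - k (d + 1)) ?_ (by omega) (by omega)
        convert Int.dvd_sub hu hd' using 1
        rw [a3.1, a3.2]
        push_cast
        ring
      subst a4
      exact ⟨by omega, a3.1, a3.2⟩
  have hle : u + v ≤ N := by
    by_contra hcon
    rcases hstep (N - u) (by omega) with h | h <;> omega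
  have hge : N ≤ u + v := by
    by_contra hcon
    have hu' : (j v + k (u + v) : ℤ) < j 0 + k u + 1 := by
      by_contra hcon'
      refine hs v hvN (u + v) (by omega) (by omega) (j 0 + k u + 1) ?_ (by omega) (by omega)
      convert hu using 1
      push_cast
      ring
    have hv' : (k u + j (u + v) : ℤ) < j v + k 0 + 1 := by
      by_contra hcon'
      refine hs u huN (u + v) (by omega) (by omega) (-(j v + k 0 + 1)) ?_ (by omega) (by omega)
      convert hv using 1
      push_cast
      ring
    refine hs 0 (by omega) (u + v) (by omega) (by omega)
      ((j 0 + k u + 1) - (j v + k 0 + 1)) ?_ (by omega) (by omega)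
    convert Int.dvd_add hu hv using 1
    push_cast
    ring
  refine ⟨u, v, by omega, by omega, by omega, hu, hv, fun m hm => ?_, fun m hm hmN => ?_,
    fun m hm => ?_, fun m hm hmN => ?_⟩
  · rcases hstep m (by omega) with h | h
    · exact h.2.1
    · omega
  · rcases hstep m (by omega) with h | h
    · omega
    · exact h.2.1
  · rcases hstep (m + v) (by omega) with h | h
    · omega
    · simpa using h.2.2
  · rcases hstep (m - u) (by omega) with h | h
    · simpa [Nat.sub_add_cancel hm] using h.2.2
    · omega

/-! ### Staircases -/

/-- The monomials `x^m y^n` with `m < N`, `n ≤ j m` and `x^m z^p` with `m < N`, `p ≤ k m`. -/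
def staircase (N : ℕ) (j k : ℕ → ℕ) : Set N3 :=
  {w | w.1 < N ∧ (w.2.2 = 0 ∧ w.2.1 ≤ j w.1 ∨ w.2.1 = 0 ∧ w.2.2 ≤ k w.1)}

lemma bijOn_tileIndex_staircase (N : ℕ) (j k : ℕ → ℕ) :
    Set.BijOn (fun p : Σ _ : ℕ, ℤ => ((p.1, p.2.toNat, (-p.2).toNat) : N3))
      (tileIndex N j k) (staircase N j k) := by
  refine ⟨?_, ?_, ?_⟩
  · rintro ⟨m, t⟩ h
    obtain ⟨hm, h1, h2⟩ := mem_tileIndex.1 (Finset.mem_coe.1 h)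
    simp only [staircase, Set.mem_ofPred_eq] at *
    omega
  · rintro ⟨m, t⟩ - ⟨m', t'⟩ - h
    simp only [Prod.mk.injEq] at h
    obtain ⟨rfl, h1, h2⟩ := h
    rw [show t = t' by omega]
  · rintro ⟨m, n, p⟩ h
    simp only [staircase, Set.mem_ofPred_eq] at h
    refine ⟨⟨m, n - p⟩, mem_tileIndex.2 ⟨h.1, ?_, ?_⟩, ?_⟩
    · dsimp only; omega
    · dsimp only; omega
    · simp only [Prod.mk.injEq, true_and]
      omega

lemma wtN_eq {r a : ℕ} (har : a ≤ r) (v : N3) :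
    wtN r a v = v.1 + a * (v.2.1 - v.2.2 : ZMod r) := by
  simp only [wtN, wtZ, toZ, Nat.cast_sub har, CharP.cast_eq_zero, Int.cast_natCast]
  ring

lemma bijOn_staircase_iff {r a b : ℕ} (har : a ≤ r) (hab : (a : ZMod r) * b = 1) (N : ℕ)
    (j k : ℕ → ℕ) :
    Set.BijOn (wtN r a) (staircase N j k) Set.univ ↔ Tiles r b N j k := by
  have hb := bijOn_tileIndex_staircase N j k
  have hmul : Function.Bijective (fun z : ZMod r => (a : ZMod r) * z) :=
    Function.bijective_iff_has_inverse.2 ⟨fun z => b * z,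
      fun z => by linear_combination z * hab,
      fun z => by linear_combination z * hab⟩
  have hcomp : (wtN r a ∘ fun p : Σ _ : ℕ, ℤ => ((p.1, p.2.toNat, (-p.2).toNat) : N3)) =
      (fun z : ZMod r => (a : ZMod r) * z) ∘
        fun p : Σ _ : ℕ, ℤ => (((b : ℤ) * p.1 + p.2 : ℤ) : ZMod r) := by
    funext ⟨m, t⟩
    have ht : ((t.toNat : ZMod r) - ((-t).toNat : ZMod r)) = (t : ZMod r) := by
      conv_rhs => rw [← Int.toNat_sub_toNat_neg t]
      push_cast
      rfl
    simp only [Function.comp, wtN_eq har, ht]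
    push_cast
    rw [mul_add, ← mul_assoc, hab, one_mul]
  constructor
  · intro h
    have h' := h.comp hb
    rw [hcomp] at h'
    refine ⟨fun _ _ => Set.mem_univ _, fun p hp q hq hpq => h'.injOn hp hq ?_, fun z _ => ?_⟩
    · exact congrArg (fun z : ZMod r => (a : ZMod r) * z) hpq
    · obtain ⟨p, hp, hz⟩ := h'.surjOn (Set.mem_univ ((a : ZMod r) * z))
      exact ⟨p, hp, hmul.1 hz⟩
  · intro h
    have h' := (hmul.bijOn_univ).comp h
    rw [← hcomp] at h'
    refine ⟨fun _ _ => Set.mem_univ _, fun v hv w hw hvw => ?_, fun z _ => ?_⟩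
    · obtain ⟨p, hp, rfl⟩ := hb.surjOn hv
      obtain ⟨q, hq, rfl⟩ := hb.surjOn hw
      rw [h'.injOn hp hq hvw]
    · obtain ⟨p, hp, hz⟩ := h'.surjOn (Set.mem_univ z)
      exact ⟨_, hb.mapsTo hp, hz⟩

lemma isGSet_staircase {r a b N : ℕ} {j k : ℕ → ℕ} (har : a ≤ r) (hab : (a : ZMod r) * b = 1)
    (hN : 0 < N) (hj : ∀ m n, m ≤ n → n < N → j n ≤ j m) (hk : ∀ m n, m ≤ n → n < N → k n ≤ k m)
    (h : Tiles r b N j k) : IsGSet r a (staircase N j k) := by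
  have hdown : ∀ u w : N3, u ≤ w → w ∈ staircase N j k → u ∈ staircase N j k := by
    rintro ⟨m, n, p⟩ ⟨m', n', p'⟩ hle hw
    simp only [staircase, Set.mem_ofPred_eq, Prod.mk_le_mk] at *
    have h1 := hj m m' hle.1 hw.1
    have h2 := hk m m' hle.1 hw.1
    omega
  exact ⟨by simp [staircase, hN], fun u v huv => ⟨hdown _ _ le_self_add huv,
    hdown _ _ le_add_self huv⟩, (bijOn_staircase_iff har hab N j k).2 h⟩

lemma exists_forall_iff_lt {S : Set ℕ} (hfin : S.Finite) (hdown : ∀ m n, m ≤ n → n ∈ S → m ∈ S) :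
    ∃ N, ∀ m, m ∈ S ↔ m < N := by
  have hex : ∃ n, n ∉ S := hfin.exists_notMem
  refine ⟨Nat.find hex, fun m => ⟨fun hm => ?_, fun hm => ?_⟩⟩
  · by_contra hcon
    exact Nat.find_spec hex (hdown _ _ (not_lt.1 hcon) hm)
  · by_contra hcon
    exact Nat.find_min hex hm hcon

lemma IsGSet.exists_staircase {r a : ℕ} [NeZero r] (har : a ≤ r) {Γ : Set N3}
    (h : IsGSet r a Γ) :
    ∃ N j k, 0 < N ∧ (∀ m n, m ≤ n → n < N → j n ≤ j m) ∧ (∀ m n, m ≤ n → n < N → k n ≤ k m) ∧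
      Γ = staircase N j k := by
  have hfin : Γ.Finite := Set.Finite.of_finite_image
    (Set.toFinite (wtN r a '' Γ)) h.bij.injOn
  have hdown : ∀ u w : N3, u ≤ w → w ∈ Γ → u ∈ Γ := by
    intro u w huw hw
    obtain ⟨d, rfl⟩ := exists_add_of_le huw
    exact (h.dclosed _ _ hw).1
  have hyz : ((0, 1, 1) : N3) ∉ Γ := fun hmem => by
    have := h.bij.injOn hmem h.zero_mem (by simp [wtN_eq har])
    simp at this
  have hN : ∃ N, ∀ m, ((m, 0, 0) : N3) ∈ Γ ↔ m < N :=
    exists_forall_iff_lt (S := {m | ((m, 0, 0) : N3) ∈ Γ})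
      (hfin.preimage fun m _ n _ hmn => by simpa using hmn)
      fun m n hmn hn => hdown _ _ (by simpa using hmn) hn
  have hj : ∀ m, ∃ N, ∀ n, ((m, n, 0) : N3) ∈ Γ ↔ n < N := fun m =>
    exists_forall_iff_lt (S := {n | ((m, n, 0) : N3) ∈ Γ})
      (hfin.preimage fun m _ n _ hmn => by simpa using hmn)
      fun m n hmn hn => hdown _ _ (by simpa using hmn) hn
  have hk : ∀ m, ∃ N, ∀ p, ((m, 0, p) : N3) ∈ Γ ↔ p < N := fun m =>
    exists_forall_iff_lt (S := {p | ((m, 0, p) : N3) ∈ Γ})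
      (hfin.preimage fun m _ n _ hmn => by simpa using hmn)
      fun m n hmn hn => hdown _ _ (by simpa using hmn) hn
  obtain ⟨N, hN⟩ := hN
  choose j hj using hj
  choose k hk using hk
  have hj0 : ∀ m < N, 0 < j m := fun m hm => (hj m 0).1 ((hN m).2 hm)
  have hk0 : ∀ m < N, 0 < k m := fun m hm => (hk m 0).1 ((hN m).2 hm)
  refine ⟨N, fun m => j m - 1, fun m => k m - 1, (hN 0).1 h.zero_mem, fun m n hmn hn => ?_,
    fun m n hmn hn => ?_, ?_⟩
  · have := hj0 n hn
    have h1 : ((n, j n - 1, 0) : N3) ∈ Γ := (hj _ _).2 (by omega)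
    have h2 := (hj m _).1 (hdown (m, j n - 1, 0) _ (by simpa using hmn) h1)
    dsimp only
    omega
  · have := hk0 n hn
    have h1 : ((n, 0, k n - 1) : N3) ∈ Γ := (hk _ _).2 (by omega)
    have h2 := (hk m _).1 (hdown (m, 0, k n - 1) _ (by simpa using hmn) h1)
    dsimp only
    omega
  · ext ⟨m, n, p⟩
    simp only [staircase, Set.mem_ofPred_eq]
    constructor
    · intro hmem
      have hm := (hN m).1 (hdown (m, 0, 0) _ (by simp) hmem)
      have h1 := (hj m n).1 (hdown (m, n, 0) _ (by simp) hmem)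
      have h2 := (hk m p).1 (hdown (m, 0, p) _ (by simp) hmem)
      have h3 : ¬ (1 ≤ n ∧ 1 ≤ p) := fun hnp => hyz (hdown _ _ (by simpa using hnp) hmem)
      omega
    · rintro ⟨hm, ⟨rfl, hn⟩ | ⟨rfl, hp⟩⟩
      · have := hj0 m hm
        exact (hj m n).2 (by omega)
      · have := hk0 m hm
        exact (hk m p).2 (by omega)

/-! ### Classification and counting -/

/-- The `G`-set with one row `y^q, …, 1, …, z^(r-1-q)`. -/
def rowSet (r q : ℕ) : Set N3 := staircase 1 (fun _ => q) (fun _ => r - 1 - q)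

/-- The `G`-set attached to a two-gap configuration and the heights `s`, `t` of its last row. -/
def gapSet (x : GapData) (s t : ℕ) : Set N3 :=
  staircase (x.u + x.v) (fun m => if m < x.v then x.α - 1 - s else t)
    (fun m => if m < x.u then x.β - 1 - t else s)

lemma sum_gap (u v A B s t : ℕ) :
    ∑ m ∈ Finset.range (u + v),
      ((if m < v then A else t) + (if m < u then B else s) + 1) =
      v * (A + s + 1) + u * (B + t + 1) := by
  have h : ∀ c d p q : ℕ, ∑ m ∈ Finset.range (c + d), (if m < c then p else q) =
      c * p + d * q := by
    intro c d p q
    rw [Finset.sum_range_add]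
    congr 1
    · rw [Finset.sum_congr rfl fun m hm => if_pos (Finset.mem_range.1 hm)]
      simp
    · simp
  rw [Finset.sum_add_distrib, Finset.sum_add_distrib, h u v, add_comm u v, h v u]
  simp
  ring

lemma isGSet_rowSet {r a b q : ℕ} [NeZero r] (har : a ≤ r) (hab : (a : ZMod r) * b = 1)
    (hq : q < r) : IsGSet r a (rowSet r q) := by
  refine isGSet_staircase har hab one_pos (fun _ _ _ _ => le_rfl) (fun _ _ _ _ => le_rfl)
    (tiles_of_cover ?_ one_pos fun m hm => ⟨0, one_pos, ?_⟩)
  · simp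
    omega
  · obtain rfl : m = 0 := by omega
    exact ⟨1, by push_cast; omega⟩

lemma GapData.Refines.spec {b c : ℕ} {x : GapData} (h : Refines ⟨1, 1, b, c⟩ x) :
    0 < x.α ∧ 0 < x.β ∧ 0 < x.u ∧ 0 < x.v ∧ x.v * x.α + x.u * x.β = b + c ∧
      ((b + c : ℕ) : ℤ) ∣ b * x.u - x.α ∧ ((b + c : ℕ) : ℤ) ∣ b * x.v + x.β := by
  obtain ⟨h1, h2, p, d, e, f, h3, h4, h5, h6, h7⟩ := h
  dsimp only at h4 h5 h6 h7
  rw [mul_one, mul_one] at h4 h5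
  have hp : 0 < p := by
    rcases Nat.eq_zero_or_pos p with rfl | h
    · simp at h3
    · exact h
  have hf : 0 < f := by
    rcases Nat.eq_zero_or_pos f with rfl | h
    · simp at h3
    · exact h
  zify at h3 h4 h5 h6 h7
  refine ⟨h1, h2, by omega, by omega, ?_, ⟨d, ?_⟩, ⟨f, ?_⟩⟩
  · zify
    rw [h4, h5, eq_sub_of_add_eq h6, eq_sub_of_add_eq h7]
    linear_combination (b + c : ℤ) * h3
  · rw [h4]
    push_cast
    linear_combination -h6
  · rw [h5]
    push_cast
    linear_combination h7

lemma GapData.refines_of_spec {b c : ℕ} {x : GapData} (hb : 0 < b) (hc : 0 < c) (hα : 0 < x.α)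
    (hβ : 0 < x.β) (hu : 0 < x.u) (hv : 0 < x.v) (hsum : x.v * x.α + x.u * x.β = b + c)
    (h1 : ((b + c : ℕ) : ℤ) ∣ b * x.u - x.α) (h2 : ((b + c : ℕ) : ℤ) ∣ b * x.v + x.β) :
    Refines ⟨1, 1, b, c⟩ x := by
  obtain ⟨d, hd⟩ := h1
  obtain ⟨f, hf⟩ := h2
  have hα' : (x.α : ℤ) < b + c := by exact_mod_cast (by nlinarith : x.α < b + c)
  have hβ' : (x.β : ℤ) < b + c := by exact_mod_cast (by nlinarith : x.β < b + c)
  push_cast at hd hf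
  zify at hb hc hα hβ hu hv hsum
  have d0 : 0 ≤ d := by
    by_contra hcon
    nlinarith [mul_pos hb hu]
  have e0 : 0 ≤ x.v - f := by
    by_contra hcon
    nlinarith [mul_pos hc hv]
  have c0 : 0 ≤ x.u - d := by
    by_contra hcon
    nlinarith [mul_pos hc hu]
  have f0 : 0 ≤ f := by
    by_contra hcon
    nlinarith [mul_pos hb hv]
  refine ⟨by exact_mod_cast hα, by exact_mod_cast hβ, (x.u - d).toNat, d.toNat, (x.v - f).toNat,
    f.toNat, ?_, ?_, ?_, ?_, ?_⟩ <;> zify <;>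
    simp only [Int.toNat_of_nonneg d0, Int.toNat_of_nonneg e0, Int.toNat_of_nonneg c0,
      Int.toNat_of_nonneg f0]
  · have hr : (b + c : ℤ) ≠ 0 := by omega
    apply mul_left_cancel₀ hr
    linear_combination hsum + x.v * hd - x.u * hf
  · ring
  · ring
  · linear_combination -hd
  · linear_combination hf

lemma isGSet_gapSet {r a b c s t : ℕ} [NeZero r] {x : GapData} (har : a ≤ r)
    (hab : (a : ZMod r) * b = 1) (hr : b + c = r) (hx : GapData.Refines ⟨1, 1, b, c⟩ x)
    (hst : s + t < min x.α x.β) : IsGSet r a (gapSet x s t) := by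
  obtain ⟨hα, hβ, hu, hv, hsum, h1, h2⟩ := hx.spec
  rw [hr] at hsum h1 h2
  rw [lt_min_iff] at hst
  refine isGSet_staircase har hab (by omega) (fun m n hmn _ => ?_) (fun m n hmn _ => ?_)
    (tiles_of_cover ?_ (by omega) fun m hm => ?_)
  · split_ifs <;> omega
  · split_ifs <;> omega
  · rw [sum_gap, ← hsum]
    congr 2 <;> omega
  · rcases lt_or_ge m x.v with hmv | hmv
    · refine ⟨m + x.u, by omega, ?_⟩
      rw [if_pos hmv, if_neg (by omega), ← Int.dvd_neg]
      convert h1 using 1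
      rw [show x.α - 1 - s = x.α - (s + 1) by omega, Nat.cast_sub (by omega : s + 1 ≤ x.α)]
      push_cast
      ring
    · refine ⟨m - x.v, by omega, ?_⟩
      rw [if_neg (by omega), if_pos (by omega)]
      convert h2 using 1
      rw [show x.β - 1 - t = x.β - (t + 1) by omega, Nat.cast_sub (by omega : t + 1 ≤ x.β),
        Nat.cast_sub hmv]
      push_cast
      ring

lemma IsGSet.eq_rowSet_or_gapSet {r a b c : ℕ} [NeZero r] {Γ : Set N3} (har : a ≤ r)
    (hab : (a : ZMod r) * b = 1) (hr : b + c = r) (hb : 0 < b) (hc : 0 < c) (h : IsGSet r a Γ) :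
    (∃ q < r, Γ = rowSet r q) ∨ ∃ x s t, GapData.Refines ⟨1, 1, b, c⟩ x ∧
      s + t < min x.α x.β ∧ Γ = gapSet x s t := by
  obtain ⟨N, j, k, hN, hj, hk, rfl⟩ := h.exists_staircase har
  have htile := (bijOn_staircase_iff har hab N j k).1 h.bij
  have hsum := htile.sum_eq
  rcases Nat.lt_or_ge 1 N with hN1 | hN1
  · right
    obtain ⟨u, v, hu, hv, rfl, h1, h2, hj0, hj1, hk0, hk1⟩ :=
      exists_two_gap htile.covers htile.separated hN1 hj hk
    have e1 := hj 0 v (by omega) (by omega)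
    have e2 := hk 0 u (by omega) (by omega)
    have hj' : ∀ m < u + v, j m = if m < v then j 0 else j v := fun m hm => by
      split_ifs with hmv
      · exact hj0 m hmv
      · exact hj1 m (by omega) hm
    have hk' : ∀ m < u + v, k m = if m < u then k 0 else k u := fun m hm => by
      split_ifs with hmu
      · exact hk0 m hmu
      · exact hk1 m (by omega) hm
    have hsum' : v * (j 0 + k u + 1) + u * (k 0 + j v + 1) = r := by
      rw [← hsum, ← sum_gap]
      refine Finset.sum_congr rfl fun m hm => ?_
      rw [← hj' m (Finset.mem_range.1 hm), ← hk' m (Finset.mem_range.1 hm)]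
    refine ⟨⟨u, v, j 0 + k u + 1, j v + k 0 + 1⟩, k u, j v,
      GapData.refines_of_spec hb hc (by dsimp only; omega) (by dsimp only; omega) hu hv
        (by rw [hr, ← hsum']; dsimp only; ring)
        (by rw [hr]; push_cast; exact h1) (by rw [hr]; push_cast; exact h2), ?_, ?_⟩
    · rw [lt_min_iff]
      dsimp only
      omega
    · ext ⟨m, n, p⟩
      simp only [gapSet, staircase, Set.mem_ofPred_eq]
      refine and_congr_right fun hm => ?_
      rw [hj' m hm, hk' m hm, show j 0 + k u + 1 - 1 - k u = j 0 by omega,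
        show j v + k 0 + 1 - 1 - j v = k 0 by omega]
  · left
    obtain rfl : N = 1 := by omega
    rw [Finset.sum_range_one] at hsum
    refine ⟨j 0, by omega, ?_⟩
    ext ⟨m, n, p⟩
    simp only [rowSet, staircase, Set.mem_ofPred_eq]
    refine and_congr_right fun hm => ?_
    obtain rfl : m = 0 := by omega
    rw [show r - 1 - j 0 = k 0 by omega]

lemma staircase_eq {N N' : ℕ} {j j' k k' : ℕ → ℕ} (h : staircase N j k = staircase N' j' k') :
    N = N' ∧ ∀ m < N, j m = j' m ∧ k m = k' m := by
  have hmem : ∀ w : N3, w ∈ staircase N j k ↔ w ∈ staircase N' j' k' := fun w => by rw [h]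
  simp only [staircase, Set.mem_ofPred_eq] at hmem
  have hN : N = N' := by
    have e1 := hmem (N, 0, 0)
    have e2 := hmem (N', 0, 0)
    dsimp only at e1 e2
    omega
  subst hN
  refine ⟨rfl, fun m hm => ?_⟩
  have e1 := hmem (m, j m, 0)
  have e2 := hmem (m, j' m, 0)
  have e3 := hmem (m, 0, k m)
  have e4 := hmem (m, 0, k' m)
  dsimp only at e1 e2 e3 e4
  omega

lemma rowSet_injective (r : ℕ) : Function.Injective (rowSet r) := fun _ _ h =>
  ((staircase_eq h).2 0 one_pos).1

lemma rowSet_ne_gapSet {r q s t : ℕ} {x : GapData} (hu : 0 < x.u) (hv : 0 < x.v) :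
    rowSet r q ≠ gapSet x s t := fun h => by
  have := (staircase_eq h).1
  omega

/-- Pairs `(s, t)` with `s + t < n`. -/
def triangle (n : ℕ) : Finset (Σ _ : ℕ, ℕ) := (Finset.range n).sigma fun s => Finset.range (n - s)

lemma mem_triangle {n : ℕ} {p : Σ _ : ℕ, ℕ} : p ∈ triangle n ↔ p.1 + p.2 < n := by
  simp only [triangle, Finset.mem_sigma, Finset.mem_range]
  omega

lemma two_mul_card_triangle (n : ℕ) : 2 * (triangle n).card = n * (n + 1) := by
  have h : (triangle n).card = ∑ s ∈ Finset.range n, (s + 1) := by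
    simp only [triangle, Finset.card_sigma, Finset.card_range]
    rw [← Finset.sum_range_reflect]
    refine Finset.sum_congr rfl fun s hs => ?_
    have := Finset.mem_range.1 hs
    omega
  rw [h]
  clear h
  induction n with
  | zero => simp
  | succ n ih =>
    rw [Finset.sum_range_succ, mul_add, ih]
    ring

/-- The number of `G`-sets for the action of type `1/r (1, a, r−a)` is
`(3r + b(r−b) − 1)/2`, where `b` is the inverse of `a` mod `r`. -/
theorem stmt18 (r a : ℕ) (hra : Nat.Coprime r a) (ha2 : 2 ≤ a) (halt : a < r - a) (b : ℕ) (hb1 : 1 ≤ b) (hb2 : b ≤ r - 1)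
    (hab : a * b ≡ 1 [MOD r]) :
    {Γ : Set N3 | IsGSet r a Γ}.Finite ∧
    {Γ : Set N3 | IsGSet r a Γ}.ncard = (3 * r + b * (r - b) - 1) / 2 := by
  have hr : 0 < r := by omega
  have : NeZero r := ⟨hr.ne'⟩
  obtain ⟨c, rfl⟩ : ∃ c, r = b + c := ⟨r - b, by omega⟩
  have hc : 0 < c := by omega
  have har : a ≤ b + c := by omega
  have hab' : (a : ZMod (b + c)) * b = 1 := by
    have := (ZMod.natCast_eq_natCast_iff _ _ _).2 hab
    push_cast at this
    exact_mod_cast this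
  have hcop : Nat.Coprime b c := by
    have h1 : IsUnit (b : ZMod (b + c)) := IsUnit.of_mul_eq_one _ ((mul_comm _ _).trans hab')
    have h2 := (ZMod.isUnit_iff_coprime b (b + c)).1 h1
    simpa using h2
  obtain ⟨F, hF, hinj, hsum⟩ := GapData.exists_finset_refines (b + c) ⟨1, 1, b, c⟩ rfl one_pos
    one_pos hb1 hc hcop
  dsimp only at hsum
  set T := F.sigma fun x => triangle (min x.α x.β) with hT
  set rows := (Finset.range (b + c)).image (rowSet (b + c)) with hrows
  set gaps := T.image fun p => gapSet p.1 p.2.1 p.2.2 with hgaps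
  have hset : {Γ : Set N3 | IsGSet (b + c) a Γ} = ↑(rows ∪ gaps) := by
    ext Γ
    simp only [Set.mem_ofPred_eq, Finset.coe_union, Set.mem_union, Finset.mem_coe, hrows, hgaps,
      Finset.mem_image, Finset.mem_range, hT, Finset.mem_sigma, mem_triangle, hF]
    constructor
    · intro h
      rcases h.eq_rowSet_or_gapSet har hab' rfl hb1 hc with ⟨q, hq, rfl⟩ | ⟨x, s, t, hx, hst, rfl⟩
      · exact Or.inl ⟨q, hq, rfl⟩
      · exact Or.inr ⟨⟨x, s, t⟩, ⟨hx, hst⟩, rfl⟩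
    · rintro (⟨q, hq, rfl⟩ | ⟨⟨x, s, t⟩, ⟨hx, hst⟩, rfl⟩)
      · exact isGSet_rowSet har hab' hq
      · exact isGSet_gapSet har hab' rfl hx hst
  have hdisj : Disjoint rows gaps := by
    rw [Finset.disjoint_left]
    intro Γ h1 h2
    simp only [hrows, hgaps, Finset.mem_image, hT, Finset.mem_sigma, hF] at h1 h2
    obtain ⟨q, -, rfl⟩ := h1
    obtain ⟨⟨x, s, t⟩, ⟨hx, -⟩, h⟩ := h2
    obtain ⟨-, -, hu, hv, -⟩ := hx.spec
    exact rowSet_ne_gapSet hu hv h.symm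
  have hrowcard : rows.card = b + c := by
    rw [hrows, Finset.card_image_of_injective _ (rowSet_injective _), Finset.card_range]
  have hgapcard : gaps.card = T.card := by
    refine Finset.card_image_of_injOn ?_
    rintro ⟨x, s, t⟩ hp ⟨x', s', t'⟩ hp' h
    simp only [hT, Finset.mem_coe, Finset.mem_sigma] at hp hp'
    obtain ⟨hN, hrest⟩ := staircase_eq h
    obtain rfl := hinj x hp.1 x' hp'.1 hN
    obtain ⟨-, -, hu, hv, -⟩ := ((hF x).1 hp.1).spec
    have := hrest (x.u + x.v - 1) (by dsimp only; omega)
    dsimp only at this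
    rw [if_neg (by omega), if_neg (by omega), if_neg (by omega), if_neg (by omega)] at this
    obtain ⟨rfl, rfl⟩ := this
    rfl
  have hTcard : 2 * T.card + 1 = b * c + b + c := by
    rw [← hsum, hT, Finset.card_sigma, Finset.mul_sum]
    simp only [two_mul_card_triangle]
  rw [hset]
  refine ⟨Finset.finite_toSet _, ?_⟩
  rw [Set.ncard_coe_finset, Finset.card_union_of_disjoint hdisj, hrowcard, hgapcard,
    Nat.add_sub_cancel_left]
  omega

end GH
end
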